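/- Let K be a field of characteristic 0, P = K[x_1,…,x_n,y_1,…,y_n] bigraded with deg x_i = (1,0), deg y_i = (0,1), P_+ = (y_1,…,y_n), n ≥ 2, r ∈ ℕ, and let λ ∈ K^n lie in the Zariski open set for which reg H^n_{P_+}(P/f_λ^r P)_j = −n−j+r−1, where f_λ = Σ_{i=1}^n λ_i x_i y_i. Then for all j ≤ −n, reg H^{n−1}_{P_+}(P/f_λ^r P)_j = −n − j + r + 1. -/

import Mathlib

/-!
Formalization of a statement from "On the regularity of local cohomology of bigraded algebras"
(A. Rahimi). Here `P₀ = K[x₁,…,x_m]`, `P = P₀[y₁,…,yₙ]` is bigraded with `deg xᵢ = (1,0)`,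
`deg yⱼ = (0,1)`, and `P₊ = (y₁,…,yₙ)`.  The top local cohomology `H^n_{P₊}(P)` is the free
`P₀`-module `⊕_c P₀ z^c` (`c : Fin n →₀ ℕ`, `z^c` of bidegree `(0, -n - |c|)`), on which a
bihomogeneous `f = Σ_β f_β y^β ∈ P` acts by the contraction `f ⬝ z^c = Σ_{β ≤ c} f_β z^{c-β}`.
For a hypersurface ring `R = P/fP` this yields the exact presentation
`⊕_{|c| = -n-j+b} P₀(-a) z^c → ⊕_{|c| = -n-j} P₀ z^c → H^n_{P₊}(R)_j → 0`
(with `(a,b) = bideg f`), and `H^{n-1}_{P₊}(R)_j` is the kernel of the first map.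
-/

open MvPolynomial

namespace Paper

/-- Total degree of an exponent vector. -/
def tdeg {n : ℕ} (c : Fin n →₀ ℕ) : ℕ := c.sum fun _ e => e

variable (A : Type) [CommRing A] (n : ℕ)

/-- The underlying module of the top local cohomology `H^n_{P₊}(P)` of `P = A[y₁,…,yₙ]`:
the free `A`-module with basis `z^c`, `c : Fin n →₀ ℕ` (`z^c` lies in `y`-degree `-n - |c|`). -/
abbrev Wmod := (Fin n →₀ ℕ) →₀ A

/-- The free `A`-submodule of `Wmod` spanned by the `z^c` with `|c| = k`;
this is the graded component `H^n_{P₊}(P)_j` for `j = -n-k`. -/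
noncomputable def Fk (k : ℕ) : Submodule A (Wmod A n) :=
  Finsupp.supported A A {c | tdeg c = k}

open scoped Classical in
/-- The contraction action of `f ∈ P = A[y₁,…,yₙ]` on `H^n_{P₊}(P)`:
`f ⬝ z^c = Σ_{β ≤ c} f_β z^{c-β}`, where `f = Σ_β f_β y^β` with `f_β ∈ A`. -/
noncomputable def contract (f : MvPolynomial (Fin n) A) :
    Wmod A n →ₗ[A] Wmod A n :=
  Finsupp.lsum A fun c =>
    (LinearMap.id : A →ₗ[A] A).smulRight
      (f.support.sum fun β => if β ≤ c then Finsupp.single (c - β) (MvPolynomial.coeff β f) else 0)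

variable (K : Type) [Field K] (m : ℕ)

/-- `f ∈ P = K[x₁,…,x_m][y₁,…,yₙ]` is bihomogeneous of bidegree `(a,b)`:
every monomial `x^ν y^β` occurring in `f` has `|ν| = a` and `|β| = b`. -/
def IsBihom (f : MvPolynomial (Fin n) (MvPolynomial (Fin m) K)) (a b : ℕ) : Prop :=
  ∀ β ν, MvPolynomial.coeff ν (MvPolynomial.coeff β f) ≠ 0 → tdeg ν = a ∧ tdeg β = b

/-- The `x`-degree-`i` strand of `Wmod` (coefficients homogeneous of degree `i`). -/
def strandW (i : ℤ) : Submodule K (Wmod (MvPolynomial (Fin m) K) n) where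
  carrier := {w | ∀ c ν, MvPolynomial.coeff ν (w c) ≠ 0 → (tdeg ν : ℤ) = i}
  add_mem' := by
    intro a b ha hb c ν h
    rw [Finsupp.add_apply, MvPolynomial.coeff_add] at h
    by_cases h1 : MvPolynomial.coeff ν (a c) ≠ 0
    · exact ha c ν h1
    · push_neg at h1
      exact hb c ν (by simpa [h1] using h)
  zero_mem' := by intro c ν h; simp at h
  smul_mem' := by
    intro k w hw c ν h
    rw [Finsupp.smul_apply, MvPolynomial.coeff_smul] at h
    exact hw c ν (right_ne_zero_of_smul h)

/-- The submodule `U_j ⊆ F_j = ⊕_{|c| = t} P₀ z^c` (`j = -n-t`): the image of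
`⊕_{|c| = t+b} P₀(-a) z^c` under multiplication by `f` on `H^n_{P₊}(P)`. -/
noncomputable def Uf (f : MvPolynomial (Fin n) (MvPolynomial (Fin m) K)) (t b : ℕ) :
    Submodule (MvPolynomial (Fin m) K) (Wmod (MvPolynomial (Fin m) K) n) :=
  Submodule.map (contract (MvPolynomial (Fin m) K) n f) (Fk (MvPolynomial (Fin m) K) n (t + b))

/-- The graded component `H^n_{P₊}(P/fP)_j`, `j = -n-t`, realized as the image of
`F_j = ⊕_{|c| = t} P₀ z^c` in `Wmod/U_j`; i.e. the cokernel `F_j/U_j` of the presentation. -/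
noncomputable def topH (f : MvPolynomial (Fin n) (MvPolynomial (Fin m) K)) (t b : ℕ) :
    Submodule (MvPolynomial (Fin m) K)
      ((Wmod (MvPolynomial (Fin m) K) n) ⧸ Uf n K m f t b) :=
  Submodule.map (Uf n K m f t b).mkQ (Fk (MvPolynomial (Fin m) K) n t)

/-- The `x`-degree-`i` component of `H^n_{P₊}(P/fP)_j`, `j = -n-t`, inside `Wmod/U_j`. -/
noncomputable def topHcomp (f : MvPolynomial (Fin n) (MvPolynomial (Fin m) K)) (t b : ℕ)
    (i : ℤ) : Submodule K ((Wmod (MvPolynomial (Fin m) K) n) ⧸ Uf n K m f t b) :=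
  Submodule.map ((Uf n K m f t b).mkQ.restrictScalars K)
    (strandW n K m i ⊓ (Fk (MvPolynomial (Fin m) K) n t).restrictScalars K)

/-- The grading (by `x`-degree) of `H^n_{P₊}(P/fP)_j`, `j = -n-t`. -/
noncomputable def topHgr (f : MvPolynomial (Fin n) (MvPolynomial (Fin m) K)) (t b : ℕ)
    (i : ℤ) : Submodule K ↥(topH n K m f t b) :=
  Submodule.comap ((topH n K m f t b).subtype.restrictScalars K) (topHcomp n K m f t b i)

/-- `H^{n-1}_{P₊}(P/fP)_j`, `j = -n-t`: the kernel of multiplication by `f` from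
`⊕_{|c| = t+b} P₀(-a) z^c` to `⊕_{|c| = t} P₀ z^c`. -/
noncomputable def syzM (f : MvPolynomial (Fin n) (MvPolynomial (Fin m) K)) (t b : ℕ) :
    Submodule (MvPolynomial (Fin m) K) (Wmod (MvPolynomial (Fin m) K) n) :=
  LinearMap.ker (contract (MvPolynomial (Fin m) K) n f) ⊓ Fk (MvPolynomial (Fin m) K) n (t + b)

/-- The grading of `H^{n-1}_{P₊}(P/fP)_j`, `j = -n-t`: since it lives inside
`⊕_{|c| = t+b} P₀(-a) z^c`, its degree-`i` component consists of the elements whose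
coefficients are homogeneous of degree `i - a`. -/
noncomputable def syzGr (f : MvPolynomial (Fin n) (MvPolynomial (Fin m) K)) (t b a : ℕ)
    (i : ℤ) : Submodule K ↥(syzM n K m f t b) :=
  Submodule.comap ((syzM n K m f t b).subtype.restrictScalars K) (strandW n K m (i - a))

section CMregularity

variable (K : Type) [Field K] (m : ℕ)
variable (N : Type) [AddCommGroup N] [Module (MvPolynomial (Fin m) K) N]
  [Module K N] [IsScalarTower K (MvPolynomial (Fin m) K) N]

/-- The Koszul differential on `x₁,…,x_m` with values in the `P₀ = K[x₁,…,x_m]`-module `N`;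
the Koszul complex on `x₁,…,x_m` is a graded free resolution of `K` over `P₀`, so its homology
with values in `N` computes the graded modules `Tor_i^{P₀}(N, K)`. -/
noncomputable def kosD (i : ℕ) :
    ({S : Finset (Fin m) // S.card = i + 1} →₀ N) →ₗ[MvPolynomial (Fin m) K]
      ({S : Finset (Fin m) // S.card = i} →₀ N) :=
  Finsupp.lsum (MvPolynomial (Fin m) K) fun S =>
    S.1.attach.sum fun l =>
      ((-1 : ℤ) ^ (S.1.filter (fun l' => l' < l.1)).card) •
        ((Finsupp.lsingle (⟨S.1.erase l.1, by
            simp [Finset.card_erase_of_mem l.2, S.2]⟩ :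
            {T : Finset (Fin m) // T.card = i})).comp
          (LinearMap.lsmul (MvPolynomial (Fin m) K) N (MvPolynomial.X l.1)))

/-- The cycles of the Koszul complex with values in `N` at homological degree `i`. -/
noncomputable def kosKer : ∀ i : ℕ,
    Submodule (MvPolynomial (Fin m) K) ({S : Finset (Fin m) // S.card = i} →₀ N)
  | 0 => ⊤
  | i + 1 => LinearMap.ker (kosD K m N i)

/-- The (internal) degree-`e` strand of the `i`-th Koszul module (the basis element `e_S`,
`|S| = i`, has internal degree `i`), relative to a grading `ℬ` of `N`. -/
def kosStrand (ℬ : ℤ → Submodule K N) (i : ℕ) (e : ℤ) :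
    Submodule K ({S : Finset (Fin m) // S.card = i} →₀ N) where
  carrier := {w | ∀ S, w S ∈ ℬ (e - i)}
  add_mem' := by
    intro a b ha hb S
    rw [Finsupp.add_apply]
    exact add_mem (ha S) (hb S)
  zero_mem' := by intro S; simp
  smul_mem' := by
    intro k w hw S
    rw [Finsupp.smul_apply]
    exact Submodule.smul_mem _ _ (hw S)

/-- The Castelnuovo–Mumford regularity over `P₀ = K[x₁,…,x_m]` of a finitely generated
graded `P₀`-module `N` with grading `ℬ`:
`reg N = max { e : Tor_i^{P₀}(N, K)_{e+i} ≠ 0 for some i }`, where the graded `Tor` modules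
are computed as the homology of the graded Koszul complex on `x₁,…,x_m` with values in `N`. -/
noncomputable def CMreg (ℬ : ℤ → Submodule K N) : ℤ :=
  sSup {e : ℤ | ∃ i : ℕ,
    Submodule.map ((LinearMap.range (kosD K m N i)).mkQ.restrictScalars K)
      (kosStrand K m N ℬ i (e + i) ⊓ (kosKer K m N i).restrictScalars K) ≠ ⊥}

end CMregularity

/-- `f_λ = Σᵢ λᵢ xᵢ yᵢ ∈ P = K[x₁,…,xₙ][y₁,…,yₙ]`. -/
noncomputable def fLam {K : Type} [Field K] {n : ℕ} (l : Fin n → K) :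
    MvPolynomial (Fin n) (MvPolynomial (Fin n) K) :=
  ∑ i : Fin n, MvPolynomial.C (MvPolynomial.C (l i) * MvPolynomial.X i) * MvPolynomial.X i

section Aux

/-- Koszul sign. -/
def eps {m : ℕ} (T : Finset (Fin m)) (l : Fin m) : ℤ := (-1) ^ (T.filter (fun l' => l' < l)).card

lemma eps_sq {m : ℕ} (T : Finset (Fin m)) (l : Fin m) : eps T l * eps T l = 1 := by
  unfold eps
  rw [← mul_pow]; simp

lemma eps_insert {m : ℕ} (T : Finset (Fin m)) (l j : Fin m) (h : l ∉ T) :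
    eps (insert l T) j = eps T j * (if l < j then -1 else 1) := by
  unfold eps
  rw [Finset.filter_insert]
  split_ifs with h1
  · rw [Finset.card_insert_of_notMem (by simp [h]), pow_succ]
  · simp

lemma eps_erase {m : ℕ} (T : Finset (Fin m)) (l j : Fin m) (h : j ∈ T) :
    eps (T.erase j) l = eps T l * (if j < l then -1 else 1) := by
  conv_rhs => rw [← Finset.insert_erase h]
  rw [eps_insert _ _ _ (by simp)]
  split_ifs <;> simp

variable {K : Type} [Field K] {m : ℕ} {N N' : Type} [AddCommGroup N] [AddCommGroup N']
  [Module (MvPolynomial (Fin m) K) N] [Module (MvPolynomial (Fin m) K) N']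

noncomputable def dL (K : Type) [Field K] (m : ℕ) (N : Type) [AddCommGroup N]
    [Module (MvPolynomial (Fin m) K) N] :
    (Finset (Fin m) → N) →ₗ[MvPolynomial (Fin m) K] (Finset (Fin m) → N) :=
  LinearMap.pi fun T => ∑ l ∈ Tᶜ, eps T l •
    ((LinearMap.lsmul (MvPolynomial (Fin m) K) N (X l)).comp (LinearMap.proj (insert l T)))

lemma dL_apply (g : Finset (Fin m) → N) (T : Finset (Fin m)) :
    dL K m N g T = ∑ l ∈ Tᶜ, eps T l • (X l : MvPolynomial (Fin m) K) • g (insert l T) := by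
  simp [dL]

lemma dL_comp (φ : N →ₗ[MvPolynomial (Fin m) K] N') (g : Finset (Fin m) → N) :
    dL K m N' (fun T => φ (g T)) = fun T => φ (dL K m N g T) := by
  funext T
  simp [dL_apply, map_sum]

/-- The homotopy. -/
def sL (D : Fin m → N →+ N) (g : Finset (Fin m) → N) (T : Finset (Fin m)) : N :=
  ∑ j ∈ T, eps T j • D j (g (T.erase j))

lemma homotopy (D : Fin m → N →+ N)
    (hD : ∀ j k n, j ≠ k → D j ((X k : MvPolynomial (Fin m) K) • n) =
      (X k : MvPolynomial (Fin m) K) • D j n) (g : Finset (Fin m) → N) (T : Finset (Fin m)) :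
    dL K m N (sL D g) T + sL D (dL K m N g) T =
      ∑ l ∈ Tᶜ, (X l : MvPolynomial (Fin m) K) • D l (g T) +
        ∑ j ∈ T, D j ((X j : MvPolynomial (Fin m) K) • g T) := by
  have h1 : dL K m N (sL D g) T = ∑ l ∈ Tᶜ, (X l : MvPolynomial (Fin m) K) • D l (g T) +
      ∑ l ∈ Tᶜ, ∑ j ∈ T, (eps T l * eps (insert l T) j) •
        (X l : MvPolynomial (Fin m) K) • D j (g ((insert l T).erase j)) := by
    rw [dL_apply, ← Finset.sum_add_distrib]
    refine Finset.sum_congr rfl fun l hl => ?_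
    have hl' : l ∉ T := by simpa using hl
    rw [sL, Finset.sum_insert hl', Finset.erase_insert hl', smul_add, smul_add, Finset.smul_sum,
      Finset.smul_sum]
    congr 1
    · rw [eps_insert _ _ _ hl', smul_comm (X l : MvPolynomial (Fin m) K), smul_smul]
      simp [eps_sq]
    · refine Finset.sum_congr rfl fun j hj => ?_
      rw [smul_comm (X l : MvPolynomial (Fin m) K), smul_smul]
  have h2 : sL D (dL K m N g) T = ∑ j ∈ T, D j ((X j : MvPolynomial (Fin m) K) • g T) +
      ∑ j ∈ T, ∑ l ∈ Tᶜ, (eps T j * eps (T.erase j) l) •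
        (X l : MvPolynomial (Fin m) K) • D j (g (insert l (T.erase j))) := by
    rw [sL, ← Finset.sum_add_distrib]
    refine Finset.sum_congr rfl fun j hj => ?_
    have : (T.erase j)ᶜ = insert j Tᶜ := by
      ext a; simp only [Finset.mem_compl, Finset.mem_erase, Finset.mem_insert]; tauto
    rw [dL_apply, this, Finset.sum_insert (by simpa using hj), Finset.insert_erase hj, map_add,
      map_sum, smul_add, Finset.smul_sum]
    congr 1
    · rw [map_zsmul, smul_smul, eps_erase _ _ _ hj]
      simp [eps_sq]
    · refine Finset.sum_congr rfl fun l hl => ?_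
      have hl' : l ∉ T := by simpa using hl
      rw [map_zsmul, smul_smul, hD j l _ (by rintro rfl; exact hl' hj)]
  have h3 : ∑ l ∈ Tᶜ, ∑ j ∈ T, (eps T l * eps (insert l T) j) •
        (X l : MvPolynomial (Fin m) K) • D j (g ((insert l T).erase j)) +
      ∑ j ∈ T, ∑ l ∈ Tᶜ, (eps T j * eps (T.erase j) l) •
        (X l : MvPolynomial (Fin m) K) • D j (g (insert l (T.erase j))) = 0 := by
    rw [Finset.sum_comm, ← Finset.sum_add_distrib]
    refine Finset.sum_eq_zero fun j hj => ?_
    rw [← Finset.sum_add_distrib]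
    refine Finset.sum_eq_zero fun l hl => ?_
    have hl' : l ∉ T := by simpa using hl
    have hne : l ≠ j := by rintro rfl; exact hl' hj
    rw [Finset.erase_insert_of_ne hne, ← add_smul, eps_insert _ _ _ hl', eps_erase _ _ _ hj]
    rcases lt_or_gt_of_ne hne with h | h
    · rw [if_pos h, if_neg h.not_gt]
      convert zero_smul ℤ _ using 2
      ring
    · rw [if_pos h, if_neg h.not_gt]
      convert zero_smul ℤ _ using 2
      ring
  rw [h1, h2]
  rw [add_add_add_comm, h3, add_zero]

lemma dL_dL [CharZero K] [Module K N] (g : Finset (Fin m) → N) :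
    dL K m N (dL K m N g) = 0 := by
  funext T
  have key : dL K m N (dL K m N g) T = ∑ l : Fin m, ∑ k : Fin m,
      if l ∉ T ∧ k ∉ T ∧ l ≠ k then (eps T l * eps (insert l T) k) •
        ((X l * X k : MvPolynomial (Fin m) K)) • g (insert k (insert l T)) else 0 := by
    rw [dL_apply]
    rw [← Finset.sum_filter_add_sum_filter_not Finset.univ (fun l => l ∉ T)]
    rw [Finset.sum_eq_zero (s := Finset.univ.filter (fun l => ¬ l ∉ T)), add_zero]
    · refine Finset.sum_congr (by ext; simp) fun l hl => ?_
      have hl' : l ∉ T := by simpa using hl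
      rw [dL_apply, Finset.smul_sum, Finset.smul_sum, ← Finset.sum_filter]
      refine Finset.sum_congr (by ext a; simp [hl', eq_comm, and_comm]) fun k hk => ?_
      rw [smul_comm (X l : MvPolynomial (Fin m) K), smul_smul, smul_smul]
    · intro l hl
      refine Finset.sum_eq_zero fun k _ => ?_
      simp at hl
      simp [hl]
  have anti : dL K m N (dL K m N g) T = - dL K m N (dL K m N g) T := by
    conv_lhs => rw [key, Finset.sum_comm]
    rw [key, ← Finset.sum_neg_distrib]
    refine Finset.sum_congr rfl fun l _ => ?_
    rw [← Finset.sum_neg_distrib]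
    refine Finset.sum_congr rfl fun k _ => ?_
    by_cases h : l ∉ T ∧ k ∉ T ∧ l ≠ k
    · rw [if_pos h, if_pos ⟨h.2.1, h.1, h.2.2.symm⟩, ← neg_smul, mul_comm (X k), Finset.insert_comm,
        eps_insert _ _ _ h.1, eps_insert _ _ _ h.2.1]
      congr 1
      rcases lt_or_gt_of_ne h.2.2 with h' | h'
      · rw [if_pos h', if_neg h'.not_gt]; ring
      · rw [if_pos h', if_neg h'.not_gt]; ring
    · rw [if_neg h, if_neg (by tauto), neg_zero]
  have h2 : (2 : K) • dL K m N (dL K m N g) T = 0 := by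
    rw [two_smul]; nth_rewrite 1 [anti]; simp
  exact (smul_eq_zero.1 h2).resolve_left two_ne_zero

/-- Extension of a chain by zero. -/
noncomputable def extC {i : ℕ} (w : {S : Finset (Fin m) // S.card = i} →₀ N) :
    Finset (Fin m) → N :=
  fun T => if h : T.card = i then w ⟨T, h⟩ else 0

/-- Restriction. -/
noncomputable def resC (i : ℕ) (g : Finset (Fin m) → N) :
    {S : Finset (Fin m) // S.card = i} →₀ N :=
  Finsupp.equivFunOnFinite.symm fun S => g S.1

lemma resC_apply (i : ℕ) (g : Finset (Fin m) → N) (S) : resC i g S = g S.1 := rfl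

lemma resC_extC {i : ℕ} (w : {S : Finset (Fin m) // S.card = i} →₀ N) : resC i (extC w) = w := by
  ext S
  simp [resC_apply, extC, S.2]

lemma kosD_apply [Module K N] [IsScalarTower K (MvPolynomial (Fin m) K) N] {i : ℕ}
    (w : {S : Finset (Fin m) // S.card = i + 1} →₀ N) (T : {S : Finset (Fin m) // S.card = i}) :
    kosD K m N i w T = dL K m N (extC w) T.1 := by
  induction w using Finsupp.induction_linear with
  | zero => 
    rw [map_zero]
    have : extC (0 : {S : Finset (Fin m) // S.card = i + 1} →₀ N) = 0 := by
      funext T; simp [extC]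
    rw [this, map_zero]; rfl
  | add f g hf hg =>
    have : extC (f + g) = extC f + extC g := by
      funext T; simp only [extC, Pi.add_apply]; split_ifs <;> simp
    rw [map_add, this, map_add, Finsupp.add_apply, hf, hg]; rfl
  | single S a =>
    rw [dL_apply]
    have h1 : kosD K m N i (Finsupp.single S a) T = ∑ l ∈ S.1.attach,
        eps S.1 l.1 • (if S.1.erase l.1 = T.1 then (X l.1 : MvPolynomial (Fin m) K) • a else 0) := by
      simp only [kosD, Finsupp.lsum_single, LinearMap.sum_apply, Finsupp.finset_sum_apply]
      refine Finset.sum_congr rfl fun l _ => ?_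
      simp only [LinearMap.smul_apply, Finsupp.smul_apply, LinearMap.comp_apply,
        Finsupp.lsingle_apply, Finsupp.single_apply, LinearMap.lsmul_apply, eps]
      congr 1
      simp only [← Subtype.coe_inj]
    rw [h1, Finset.sum_attach S.1 (fun l => eps S.1 l •
      (if S.1.erase l = T.1 then (X l : MvPolynomial (Fin m) K) • a else 0))]
    have h2 : ∀ l ∈ T.1ᶜ, eps T.1 l • (X l : MvPolynomial (Fin m) K) •
        extC (Finsupp.single S a) (insert l T.1) =
        if insert l T.1 = S.1 then eps T.1 l • (X l : MvPolynomial (Fin m) K) • a else 0 := by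
      intro l hl
      have hl' : l ∉ T.1 := by simpa using hl
      have : extC (Finsupp.single S a) (insert l T.1) = if insert l T.1 = S.1 then a else 0 := by
        simp only [extC, Finsupp.single_apply, ← Subtype.coe_inj]
        rw [dif_pos (by rw [Finset.card_insert_of_notMem hl', T.2])]
        simp only [eq_comm]
      rw [this]; split_ifs <;> simp
    rw [Finset.sum_congr rfl h2, ← Finset.sum_filter]
    simp only [smul_ite, smul_zero]
    rw [← Finset.sum_filter]
    have h3 : S.1.filter (fun l => S.1.erase l = T.1) = T.1ᶜ.filter (fun l => insert l T.1 = S.1) := by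
      ext l
      simp only [Finset.mem_filter, Finset.mem_compl]
      constructor
      · rintro ⟨h, h'⟩
        rw [← h']
        exact ⟨by simp, Finset.insert_erase h⟩
      · rintro ⟨h, h'⟩
        rw [← h']
        exact ⟨by simp, Finset.erase_insert h⟩
    rw [h3]
    refine Finset.sum_congr rfl fun l hl => ?_
    simp only [Finset.mem_filter, Finset.mem_compl] at hl
    rw [← hl.2, eps_insert _ _ _ hl.1]
    simp

/-- Reformulation of membership in the set of degrees in `CMreg`. -/
def TorNe (K : Type) [Field K] (m : ℕ) (N : Type) [AddCommGroup N]
    [Module (MvPolynomial (Fin m) K) N] [Module K N] (ℬ : ℤ → Submodule K N) (e : ℤ) : Prop :=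
  ∃ i : ℕ, ∃ g : Finset (Fin m) → N, (∀ T, g T ∈ ℬ e) ∧ (∀ T, T.card ≠ i → g T = 0) ∧
    dL K m N g = 0 ∧ ¬ ∃ h, dL K m N h = g

lemma dL_supp {i : ℕ} (g : Finset (Fin m) → N) (hg : ∀ T, T.card ≠ i + 1 → g T = 0)
    (T : Finset (Fin m)) (hT : T.card ≠ i) : dL K m N g T = 0 := by
  rw [dL_apply]
  refine Finset.sum_eq_zero fun l hl => ?_
  have hl' : l ∉ T := by simpa using hl
  rw [hg _ (by rw [Finset.card_insert_of_notMem hl']; omega), smul_zero, smul_zero]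

lemma dL_supp_zero (g : Finset (Fin m) → N) (hg : ∀ T, T.card ≠ 0 → g T = 0) :
    dL K m N g = 0 := by
  funext T
  rw [dL_apply]
  refine Finset.sum_eq_zero fun l hl => ?_
  have hl' : l ∉ T := by simpa using hl
  rw [hg _ (by rw [Finset.card_insert_of_notMem hl']; omega), smul_zero, smul_zero]

lemma extC_supp {i : ℕ} (w : {S : Finset (Fin m) // S.card = i} →₀ N) (T : Finset (Fin m))
    (hT : T.card ≠ i) : extC w T = 0 := by
  simp [extC, hT]

lemma extC_resC {i : ℕ} (g : Finset (Fin m) → N) (hg : ∀ T, T.card ≠ i → g T = 0) :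
    extC (resC i g) = g := by
  funext T
  by_cases h : T.card = i
  · simp [extC, h, resC_apply]
  · simp [extC, h, hg T h]

variable [Module K N] [IsScalarTower K (MvPolynomial (Fin m) K) N]

lemma mem_kosKer_iff {i : ℕ} (w : {S : Finset (Fin m) // S.card = i} →₀ N) :
    w ∈ kosKer K m N i ↔ dL K m N (extC w) = 0 := by
  cases i with
  | zero =>
    simp only [kosKer, Submodule.mem_top, true_iff]
    exact dL_supp_zero _ (extC_supp w)
  | succ i =>
    simp only [kosKer, LinearMap.mem_ker]
    constructor
    · intro h
      funext T
      by_cases hT : T.card = i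
      · have := DFunLike.congr_fun h ⟨T, hT⟩
        rw [kosD_apply] at this
        exact this
      · exact dL_supp _ (extC_supp w) T hT
    · intro h
      ext T
      rw [kosD_apply, h]; rfl

lemma mem_range_iff {i : ℕ} (w : {S : Finset (Fin m) // S.card = i} →₀ N) :
    w ∈ LinearMap.range (kosD K m N i) ↔ ∃ h, dL K m N h = extC w := by
  constructor
  · rintro ⟨u, rfl⟩
    refine ⟨extC u, ?_⟩
    funext T
    by_cases hT : T.card = i
    · simp [extC, hT, kosD_apply]
    · rw [dL_supp _ (extC_supp u) T hT, extC_supp _ _ hT]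
  · rintro ⟨h, hh⟩
    refine ⟨resC (i+1) h, ?_⟩
    ext T
    rw [kosD_apply]
    have h1 : w T = extC w T.1 := by simp [extC, T.2]
    rw [h1, ← hh, dL_apply, dL_apply]
    refine Finset.sum_congr rfl fun l hl => ?_
    have hl' : l ∉ T.1 := by simpa using hl
    have : (insert l T.1).card = i + 1 := by rw [Finset.card_insert_of_notMem hl', T.2]
    simp [extC, this, resC_apply]

lemma CMreg_eq (ℬ : ℤ → Submodule K N) :
    CMreg K m N ℬ = sSup {e | TorNe K m N ℬ e} := by
  unfold CMreg
  congr 1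
  ext e
  simp only [Set.mem_setOf_eq, TorNe]
  refine exists_congr fun i => ?_
  rw [Submodule.ne_bot_iff]
  constructor
  · rintro ⟨_, ⟨w, ⟨hw1, hw2⟩, rfl⟩, hx⟩
    refine ⟨extC w, ?_, extC_supp w, (mem_kosKer_iff w).1 hw2, ?_⟩
    · intro T
      by_cases h : T.card = i
      · have := hw1 ⟨T, h⟩
        rw [add_sub_cancel_right] at this
        simpa [extC, h] using this
      · rw [extC_supp _ _ h]; exact zero_mem _
    · rw [← mem_range_iff]
      intro h
      apply hx
      simpa using h
  · rintro ⟨g, h1, h2, h3, h4⟩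
    refine ⟨_, ⟨resC i g, ⟨?_, ?_⟩, rfl⟩, ?_⟩
    · intro S
      rw [add_sub_cancel_right]
      exact h1 _
    · exact (mem_kosKer_iff _).2 (by rw [extC_resC _ h2]; exact h3)
    · intro h
      apply h4
      rw [← extC_resC _ h2, ← mem_range_iff]
      simpa using h

end Aux
section AuxW

variable {K : Type} [Field K] {m n : ℕ}

lemma tdeg_eq {n : ℕ} (c : Fin n →₀ ℕ) : tdeg c = c.degree := rfl

lemma tdeg_add {n : ℕ} (c d : Fin n →₀ ℕ) : tdeg (c + d) = tdeg c + tdeg d := by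
  simp [tdeg_eq]

lemma weight_one_eq {n : ℕ} (c : Fin n →₀ ℕ) : Finsupp.weight (1 : Fin n → ℕ) c = tdeg c := by
  rw [tdeg_eq, Finsupp.degree_eq_weight_one]; rfl

/-- Coordinatewise partial derivative. -/
noncomputable def DW (K : Type) [Field K] (m n : ℕ) (j : Fin m) :
    Wmod (MvPolynomial (Fin m) K) n →+ Wmod (MvPolynomial (Fin m) K) n :=
  Finsupp.mapRange.addMonoidHom (pderiv j : Derivation K _ _).toLinearMap.toAddMonoidHom

lemma DW_apply (j : Fin m) (w : Wmod (MvPolynomial (Fin m) K) n) (c) :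
    DW K m n j w c = pderiv j (w c) := rfl

lemma mem_strandW (k : ℤ) (w : Wmod (MvPolynomial (Fin m) K) n) :
    w ∈ strandW n K m k ↔ ∀ c ν, coeff ν (w c) ≠ 0 → (tdeg ν : ℤ) = k := Iff.rfl

lemma mem_Fk {A : Type} [CommRing A] (k : ℕ) (w : Wmod A n) :
    w ∈ Fk A n k ↔ ∀ c, w c ≠ 0 → tdeg c = k := by
  simp [Fk, Finsupp.mem_supported, Set.subset_def]

lemma DW_strand {k : ℤ} {w : Wmod (MvPolynomial (Fin m) K) n} (hw : w ∈ strandW n K m k)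
    (j : Fin m) : DW K m n j w ∈ strandW n K m (k - 1) := by
  intro c ν h
  rw [DW_apply, coeff_pderiv] at h
  have := hw c _ (left_ne_zero_of_mul h)
  rw [tdeg_add] at this
  have h1 : tdeg (Finsupp.single j 1) = 1 := by simp [tdeg_eq]
  rw [h1] at this
  push_cast at this
  omega

lemma DW_Fk {k : ℕ} {w : Wmod (MvPolynomial (Fin m) K) n}
    (hw : w ∈ Fk (MvPolynomial (Fin m) K) n k)
    (j : Fin m) : DW K m n j w ∈ Fk (MvPolynomial (Fin m) K) n k := by
  rw [mem_Fk] at *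
  intro c h
  refine hw c fun h0 => h ?_
  rw [DW_apply, h0, map_zero]

lemma euler_poly (k : ℤ) (p : MvPolynomial (Fin m) K) (hp : ∀ ν, coeff ν p ≠ 0 → (tdeg ν : ℤ) = k) :
    ∑ j, X j * pderiv j p = (k : K) • p := by
  by_cases h0 : p = 0
  · simp [h0]
  obtain ⟨ν, hν⟩ := ne_zero_iff.1 h0
  have hk := hp ν hν
  have : p.IsHomogeneous (tdeg ν) := by
    intro μ hμ
    have := hp μ hμ
    rw [← hk] at this
    rw [weight_one_eq] 
    exact_mod_cast this
  have h2 := this.sum_X_mul_pderiv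
  rw [h2, ← hk]
  rw [Int.cast_natCast, Nat.cast_smul_eq_nsmul]

lemma euler_W {k : ℤ} {w : Wmod (MvPolynomial (Fin m) K) n} (hw : w ∈ strandW n K m k) :
    ∑ j, (X j : MvPolynomial (Fin m) K) • DW K m n j w = (k : K) • w := by
  ext1 c
  rw [Finsupp.finsetSum_apply, Finsupp.smul_apply, ← euler_poly k (w c) (hw c)]
  rfl

lemma exact_W [CharZero K] (g : Finset (Fin m) → Wmod (MvPolynomial (Fin m) K) n) (k : ℤ) (i : ℕ)
    (hg : ∀ T, g T ∈ strandW n K m k) (hs : ∀ T, T.card ≠ i → g T = 0)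
    (hd : dL K m _ g = 0) (hk : k + i ≠ 0) :
    ∃ u : Finset (Fin m) → Wmod (MvPolynomial (Fin m) K) n,
      (∀ T, T.card ≠ i + 1 → u T = 0) ∧ dL K m _ u = g ∧ (∀ T, u T ∈ strandW n K m (k - 1)) ∧
      ∀ L : Submodule K (Wmod (MvPolynomial (Fin m) K) n),
        (∀ j T, DW K m n j (g T) ∈ L) → ∀ T, u T ∈ L := by
  have hk' : ((k + i : ℤ) : K) ≠ 0 := by exact_mod_cast hk
  have hL : ∀ L : Submodule K (Wmod (MvPolynomial (Fin m) K) n),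
        (∀ j T, DW K m n j (g T) ∈ L) → ∀ T, sL (DW K m n) g T ∈ L := by
    intro L hL T
    refine sum_mem fun j _ => ?_
    exact zsmul_mem (hL _ _) _
  have hh : dL K m _ (sL (DW K m n) g) = ((k + i : ℤ) : K) • g := by
    funext T
    have h1 := homotopy (DW K m n) (K := K) (by
      intro j l w hjl
      ext1 c
      rw [DW_apply, Finsupp.smul_apply, Finsupp.smul_apply, DW_apply, smul_eq_mul, smul_eq_mul,
        pderiv_mul, pderiv_X_of_ne hjl.symm, zero_mul, zero_add]) g T
    have h0 : sL (DW K m n) (dL K m (Wmod (MvPolynomial (Fin m) K) n) g) T = 0 := by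
      rw [hd]
      simp [sL]
    rw [h0, add_zero] at h1
    rw [h1]
    have h2 : ∀ j ∈ T, DW K m n j ((X j : MvPolynomial (Fin m) K) • g T) =
        (X j : MvPolynomial (Fin m) K) • DW K m n j (g T) + g T := by
      intro j _
      ext1 c
      rw [DW_apply, Finsupp.smul_apply, Finsupp.add_apply, Finsupp.smul_apply, DW_apply,
        smul_eq_mul, smul_eq_mul, pderiv_mul, pderiv_X_self, one_mul, add_comm]
    rw [Finset.sum_congr rfl h2, Finset.sum_add_distrib, ← add_assoc,
      Finset.sum_compl_add_sum, euler_W (hg T), Finset.sum_const]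
    by_cases hT : T.card = i
    · rw [hT, Pi.smul_apply, ← Nat.cast_smul_eq_nsmul K, ← add_smul]
      push_cast; rfl
    · simp [hs T hT]
  refine ⟨fun T => ((k + i : ℤ) : K)⁻¹ • sL (DW K m n) g T, ?_, ?_, ?_, ?_⟩
  · intro T hT
    change ((k + i : ℤ) : K)⁻¹ • sL (DW K m n) g T = 0
    rw [sL, Finset.sum_eq_zero, smul_zero]
    intro j hj
    rw [hs, map_zero, smul_zero]
    rw [Finset.card_erase_of_mem hj]
    have := Finset.card_pos.2 ⟨j, hj⟩
    omega
  · change dL K m _ (((k + i : ℤ) : K)⁻¹ • sL (DW K m n) g) = g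
    rw [LinearMap.map_smul_of_tower, hh, smul_smul, inv_mul_cancel₀ hk', one_smul]
  · intro T
    exact Submodule.smul_mem _ _ (hL _ (fun j T => DW_strand (hg T) j) T)
  · intro L h T
    exact Submodule.smul_mem _ _ (hL L h T)

lemma contract_apply {A : Type} [CommRing A] (f : MvPolynomial (Fin n) A) (w : Wmod A n)
    (d : Fin n →₀ ℕ) :
    contract A n f w d = ∑ β ∈ f.support, coeff β f * w (d + β) := by
  classical
  induction w using Finsupp.induction_linear with
  | zero => simp
  | add f g hf hg => simp [hf, hg, mul_add, Finset.sum_add_distrib]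
  | single c a =>
    simp only [contract, Finsupp.lsum_single, LinearMap.smulRight_apply, LinearMap.id_apply,
      Finsupp.smul_apply, Finsupp.finsetSum_apply, smul_eq_mul, Finset.mul_sum]
    refine Finset.sum_congr rfl fun β _ => ?_
    by_cases h : β ≤ c
    · rw [if_pos h, Finsupp.single_apply, Finsupp.single_apply]
      have : c - β = d ↔ c = d + β := by
        constructor
        · rintro rfl; exact (tsub_add_cancel_of_le h).symm
        · rintro rfl; simp
      simp only [this]
      split_ifs <;> simp [mul_comm]
    · rw [if_neg h, Finsupp.single_apply, if_neg]
      · simp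
      · rintro rfl; exact h (by simp)

/-- Diagonal elements of bidegree `(a,a)`. -/
def Diag (a : ℕ) (f : MvPolynomial (Fin n) (MvPolynomial (Fin n) K)) : Prop :=
  ∀ β ν, coeff ν (coeff β f) ≠ 0 → ν = β ∧ tdeg β = a

lemma Diag.mul {a b : ℕ} {f g : MvPolynomial (Fin n) (MvPolynomial (Fin n) K)}
    (hf : Diag a f) (hg : Diag b g) : Diag (a + b) (f * g) := by
  classical
  intro β ν h
  rw [coeff_mul, coeff_sum] at h
  obtain ⟨x, hx, h⟩ := Finset.exists_ne_zero_of_sum_ne_zero h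
  rw [coeff_mul] at h
  obtain ⟨y, hy, h⟩ := Finset.exists_ne_zero_of_sum_ne_zero h
  rw [Finset.HasAntidiagonal.mem_antidiagonal] at hx hy
  obtain ⟨h1, h2⟩ := hf _ _ (left_ne_zero_of_mul h)
  obtain ⟨h3, h4⟩ := hg _ _ (right_ne_zero_of_mul h)
  rw [← hx, ← hy, h1, h3, tdeg_add, h2, h4]
  simp

lemma fLam_eq (l : Fin n → K) : fLam l = ∑ i : Fin n, monomial (Finsupp.single i 1)
    (monomial (Finsupp.single i 1) (l i)) := by
  unfold fLam
  refine Finset.sum_congr rfl fun i _ => ?_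
  rw [X, C_mul_monomial, mul_one, X, C_mul_monomial, mul_one]

lemma Diag_fLam (l : Fin n → K) : Diag 1 (fLam l) := by
  classical
  intro β ν h
  rw [fLam_eq, coeff_sum, coeff_sum] at h
  obtain ⟨i, _, h⟩ := Finset.exists_ne_zero_of_sum_ne_zero h
  rw [coeff_monomial] at h
  split_ifs at h with h1
  · rw [coeff_monomial] at h
    split_ifs at h with h2
    · subst h1; subst h2; simp [tdeg_eq]
    · simp at h
  · simp at h

lemma Diag_pow (l : Fin n → K) (r : ℕ) : Diag r (fLam l ^ r) := by
  classical
  induction r with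
  | zero =>
    intro β ν h
    rw [pow_zero, coeff_one] at h
    split_ifs at h with h1
    · subst h1
      rw [coeff_one] at h
      split_ifs at h with h2
      · subst h2; simp [tdeg_eq]
      · simp at h
    · simp at h
  | succ r ih => rw [pow_succ]; exact ih.mul (Diag_fLam l)

variable {r : ℕ} {f : MvPolynomial (Fin n) (MvPolynomial (Fin n) K)}

lemma Diag.tdeg_supp (hf : Diag r f) {β} (h : β ∈ f.support) : tdeg β = r := by
  rw [mem_support_iff, ne_zero_iff] at h
  obtain ⟨ν, h⟩ := h
  exact (hf _ _ h).2

lemma Diag.hom (hf : Diag r f) (β) : (coeff β f).IsHomogeneous r := by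
  intro ν h
  obtain ⟨h1, h2⟩ := hf _ _ h
  rw [weight_one_eq, h1, h2]

lemma contract_strand (hf : Diag r f) {k : ℤ} {w : Wmod (MvPolynomial (Fin n) K) n}
    (hw : w ∈ strandW n K n k) : contract _ n f w ∈ strandW n K n (k + r) := by
  classical
  intro c ν h
  rw [contract_apply, coeff_sum] at h
  obtain ⟨β, hβ, h⟩ := Finset.exists_ne_zero_of_sum_ne_zero h
  rw [coeff_mul] at h
  obtain ⟨x, hx, h⟩ := Finset.exists_ne_zero_of_sum_ne_zero h
  rw [Finset.HasAntidiagonal.mem_antidiagonal] at hx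
  have h1 := hf _ _ (left_ne_zero_of_mul h)
  have h2 := hw _ _ (right_ne_zero_of_mul h)
  rw [← hx, tdeg_add, h1.1, h1.2]
  push_cast
  omega

lemma contract_Fk (hf : Diag r f) {t : ℕ} {w : Wmod (MvPolynomial (Fin n) K) n}
    (hw : w ∈ Fk (MvPolynomial (Fin n) K) n (t + r)) :
    contract _ n f w ∈ Fk (MvPolynomial (Fin n) K) n t := by
  rw [mem_Fk] at *
  intro c h
  rw [contract_apply] at h
  obtain ⟨β, hβ, h⟩ := Finset.exists_ne_zero_of_sum_ne_zero h
  have := hw _ (right_ne_zero_of_mul h)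
  rw [tdeg_add, hf.tdeg_supp hβ] at this
  omega

/-- Projection to degree `k`. -/
noncomputable def pr (K : Type) [Field K] (m n : ℕ) (k : ℕ) :
    Wmod (MvPolynomial (Fin m) K) n →+ Wmod (MvPolynomial (Fin m) K) n :=
  Finsupp.mapRange.addMonoidHom (homogeneousComponent k).toAddMonoidHom

lemma pr_apply (k : ℕ) (w : Wmod (MvPolynomial (Fin m) K) n) (c) :
    pr K m n k w c = homogeneousComponent k (w c) := rfl

lemma hc_mul {q p : MvPolynomial (Fin m) K} {a : ℕ} (hq : q.IsHomogeneous a) (k : ℕ) :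
    homogeneousComponent (k + a) (q * p) = q * homogeneousComponent k p := by
  conv_lhs => rw [← sum_homogeneousComponent p, Finset.mul_sum, map_sum]
  have : ∀ i ∈ Finset.range (p.totalDegree + 1), homogeneousComponent (k + a)
      (q * homogeneousComponent i p) = if i = k then q * homogeneousComponent i p else 0 := by
    intro i _
    rw [homogeneousComponent_of_mem (hq.mul (homogeneousComponent_isHomogeneous i p))]
    have : k + a = a + i ↔ i = k := by omega
    simp only [this]
  rw [Finset.sum_congr rfl this, Finset.sum_ite_eq']
  split_ifs with h
  · rfl
  · rw [homogeneousComponent_eq_zero k p (by simp at h; omega), mul_zero]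

lemma pr_contract (hf : Diag r f) (k : ℕ) (w : Wmod (MvPolynomial (Fin n) K) n) :
    pr K n n (k + r) (contract _ n f w) = contract _ n f (pr K n n k w) := by
  ext1 c
  rw [pr_apply, contract_apply, contract_apply, map_sum]
  refine Finset.sum_congr rfl fun β _ => ?_
  rw [hc_mul (hf.hom β), pr_apply]

lemma pr_X (k : ℕ) (l : Fin m) (w : Wmod (MvPolynomial (Fin m) K) n) :
    pr K m n (k + 1) ((X l : MvPolynomial (Fin m) K) • w) =
      (X l : MvPolynomial (Fin m) K) • pr K m n k w := by
  ext1 c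
  rw [pr_apply, Finsupp.smul_apply, Finsupp.smul_apply, smul_eq_mul, smul_eq_mul,
    hc_mul (isHomogeneous_X _ _), pr_apply]

lemma pr_dL (k : ℕ) (g : Finset (Fin m) → Wmod (MvPolynomial (Fin m) K) n) :
    dL K m _ (fun T => pr K m n k (g T)) = fun T => pr K m n (k + 1) (dL K m _ g T) := by
  funext T
  rw [dL_apply, dL_apply, map_sum]
  refine Finset.sum_congr rfl fun l _ => ?_
  rw [map_zsmul, pr_X]

lemma pr_strand (k : ℕ) (w : Wmod (MvPolynomial (Fin m) K) n) :
    pr K m n k w ∈ strandW n K m k := by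
  intro c ν h
  rw [pr_apply, coeff_homogeneousComponent] at h
  rw [tdeg_eq]
  split_ifs at h with h1
  · rw [h1]
  · simp at h

lemma pr_eq {k : ℕ} {w : Wmod (MvPolynomial (Fin m) K) n} (hw : w ∈ strandW n K m k) :
    pr K m n k w = w := by
  ext1 c
  rw [pr_apply]
  apply homogeneousComponent_eq_self
  intro ν h
  have := hw c ν h
  rw [weight_one_eq]
  exact_mod_cast this

lemma pr_Fk (k : ℕ) {t : ℕ} {w : Wmod (MvPolynomial (Fin m) K) n}
    (hw : w ∈ Fk (MvPolynomial (Fin m) K) n t) : pr K m n k w ∈ Fk (MvPolynomial (Fin m) K) n t := by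
  rw [mem_Fk] at *
  intro c h
  refine hw c fun h0 => h ?_
  rw [pr_apply, h0, map_zero]

lemma mem_syzM {t b : ℕ} {w : Wmod (MvPolynomial (Fin n) K) n} :
    w ∈ syzM n K n f t b ↔ contract _ n f w = 0 ∧ w ∈ Fk (MvPolynomial (Fin n) K) n (t + b) := by
  simp [syzM]

lemma pr_syzM (hf : Diag r f) (k : ℕ) {t : ℕ} {w : Wmod (MvPolynomial (Fin n) K) n}
    (hw : w ∈ syzM n K n f t r) : pr K n n k w ∈ syzM n K n f t r := by
  rw [mem_syzM] at *
  refine ⟨?_, pr_Fk _ hw.2⟩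
  rw [← pr_contract hf, hw.1, map_zero]

lemma TorM_iff (f : MvPolynomial (Fin n) (MvPolynomial (Fin n) K)) (t b a : ℕ) (e : ℤ) :
    TorNe K n (syzM n K n f t b) (syzGr n K n f t b a) e ↔
    ∃ i : ℕ, ∃ w : Finset (Fin n) → Wmod (MvPolynomial (Fin n) K) n,
      (∀ T, w T ∈ strandW n K n (e - a)) ∧ (∀ T, w T ∈ syzM n K n f t b) ∧
      (∀ T, T.card ≠ i → w T = 0) ∧ dL K n _ w = 0 ∧
      ¬ ∃ u : Finset (Fin n) → Wmod (MvPolynomial (Fin n) K) n,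
        (∀ T, u T ∈ syzM n K n f t b) ∧ dL K n _ u = w := by
  unfold TorNe
  refine exists_congr fun i => ?_
  constructor
  · rintro ⟨g, h1, h2, h3, h4⟩
    refine ⟨fun T => (syzM n K n f t b).subtype (g T), fun T => h1 T, fun T => (g T).2, ?_, ?_, ?_⟩
    · intro T hT
      simp [h2 T hT]
    · rw [dL_comp (K := K) (N := ↥(syzM n K n f t b)) (syzM n K n f t b).subtype g, h3]; rfl
    · rintro ⟨u, hu, hu'⟩
      apply h4
      refine ⟨fun T => ⟨u T, hu T⟩, ?_⟩
      funext T
      apply (syzM n K n f t b).injective_subtype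
      have := congr_fun (dL_comp (K := K) (N := ↥(syzM n K n f t b)) (syzM n K n f t b).subtype (fun T => ⟨u T, hu T⟩)) T
      rw [← this]
      exact congr_fun hu' T
  · rintro ⟨w, h1, h2, h3, h4, h5⟩
    refine ⟨fun T => ⟨w T, h2 T⟩, fun T => h1 T, fun T hT => Subtype.ext (h3 T hT), ?_, ?_⟩
    · funext T
      apply (syzM n K n f t b).injective_subtype
      have := congr_fun (dL_comp (K := K) (N := ↥(syzM n K n f t b)) (syzM n K n f t b).subtype (fun T => ⟨w T, h2 T⟩)) T
      rw [← this]
      exact congr_fun h4 T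
    · rintro ⟨h, hh⟩
      apply h5
      refine ⟨fun T => (syzM n K n f t b).subtype (h T), fun T => (h T).2, ?_⟩
      rw [dL_comp (K := K) (N := ↥(syzM n K n f t b)) (syzM n K n f t b).subtype h, hh]; rfl

lemma mem_Uf {t b : ℕ} {x : Wmod (MvPolynomial (Fin n) K) n} :
    x ∈ Uf n K n f t b ↔ ∃ z ∈ Fk (MvPolynomial (Fin n) K) n (t + b), contract _ n f z = x := by
  simp [Uf]

/-- The class in `topH` of an element of `Fk`. -/
noncomputable def toH (f : MvPolynomial (Fin n) (MvPolynomial (Fin n) K)) (t b : ℕ) :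
    Fk (MvPolynomial (Fin n) K) n t →ₗ[MvPolynomial (Fin n) K] topH n K n f t b :=
  ((Uf n K n f t b).mkQ.domRestrict (Fk (MvPolynomial (Fin n) K) n t)).codRestrict _
    (fun x => ⟨x.1, x.2, rfl⟩)

lemma toH_surj (f : MvPolynomial (Fin n) (MvPolynomial (Fin n) K)) (t b : ℕ) :
    Function.Surjective (toH f t b) := by
  rintro ⟨_, x, hx, rfl⟩
  exact ⟨⟨x, hx⟩, rfl⟩

lemma toH_sub {t b : ℕ} (x y : Fk (MvPolynomial (Fin n) K) n t) :
    toH f t b (x - y) = toH f t b x - toH f t b y := rfl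

lemma toH_eq_zero {t b : ℕ} (x : Fk (MvPolynomial (Fin n) K) n t) :
    toH f t b x = 0 ↔ x.1 ∈ Uf n K n f t b := by
  rw [← Subtype.coe_inj]
  exact Submodule.Quotient.mk_eq_zero _

lemma mem_topHgr {t b : ℕ} {e : ℤ} (x : topH n K n f t b) :
    x ∈ topHgr n K n f t b e ↔ ∃ y : Fk (MvPolynomial (Fin n) K) n t,
      y.1 ∈ strandW n K n e ∧ toH f t b y = x := by
  constructor
  · rintro ⟨y, ⟨h1, h2⟩, h3⟩
    exact ⟨⟨y, h2⟩, h1, Subtype.ext h3⟩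
  · rintro ⟨y, h1, rfl⟩
    exact ⟨y.1, ⟨h1, y.2⟩, rfl⟩

lemma dL_toH {t b : ℕ} (v : Finset (Fin n) → Fk (MvPolynomial (Fin n) K) n t) (T) :
    dL K n _ (fun T => toH f t b (v T)) T = toH f t b (dL K n _ v T) :=
  congr_fun (dL_comp (toH f t b) v) T

lemma dL_val {t : ℕ} (v : Finset (Fin n) → Fk (MvPolynomial (Fin n) K) n t) (T) :
    (dL K n _ v T).1 = dL K n _ (fun T => (v T).1) T :=
  (congr_fun (dL_comp (Fk (MvPolynomial (Fin n) K) n t).subtype v) T).symm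

/-- Being a boundary modulo `U`. -/
lemma bdry_iff {t b : ℕ} (v : Finset (Fin n) → Fk (MvPolynomial (Fin n) K) n t) :
    (∃ h, dL K n _ h = (fun T => toH f t b (v T))) ↔
    ∃ y z : Finset (Fin n) → Wmod (MvPolynomial (Fin n) K) n,
      (∀ T, y T ∈ Fk (MvPolynomial (Fin n) K) n t) ∧
      (∀ T, z T ∈ Fk (MvPolynomial (Fin n) K) n (t + b)) ∧
      ∀ T, (v T).1 = dL K n _ y T + contract _ n f (z T) := by
  constructor
  · rintro ⟨h, hh⟩
    choose y hy using fun T => toH_surj f t b (h T)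
    have h1 : ∀ T, (v T - dL K n _ y T).1 ∈ Uf n K n f t b := by
      intro T
      rw [← toH_eq_zero, toH_sub, ← dL_toH, sub_eq_zero]
      have := congr_fun hh T
      rw [← this]
      rw [show h = fun T => toH f t b (y T) from _root_.funext fun T => (hy T).symm]
    choose z hz using fun T => mem_Uf.1 (h1 T)
    refine ⟨fun T => (y T).1, z, fun T => (y T).2, fun T => (hz T).1, fun T => ?_⟩
    rw [(hz T).2, ← dL_val]
    simp
  · rintro ⟨y, z, hy, hz, h⟩
    refine ⟨fun T => toH f t b ⟨y T, hy T⟩, ?_⟩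
    funext T
    rw [dL_toH, eq_comm, ← sub_eq_zero, ← toH_sub, toH_eq_zero, mem_Uf]
    refine ⟨z T, hz T, ?_⟩
    rw [Submodule.coe_sub, dL_val, h T]
    simp

lemma TorH_iff (f : MvPolynomial (Fin n) (MvPolynomial (Fin n) K)) (t b : ℕ) (e : ℤ) :
    TorNe K n (topH n K n f t b) (topHgr n K n f t b) e ↔
    ∃ i : ℕ, ∃ v : Finset (Fin n) → Wmod (MvPolynomial (Fin n) K) n,
      (∀ T, v T ∈ strandW n K n e) ∧ (∀ T, v T ∈ Fk (MvPolynomial (Fin n) K) n t) ∧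
      (∀ T, T.card ≠ i → v T = 0) ∧ (∀ T, dL K n _ v T ∈ Uf n K n f t b) ∧
      ¬ ∃ y z : Finset (Fin n) → Wmod (MvPolynomial (Fin n) K) n,
        (∀ T, y T ∈ Fk (MvPolynomial (Fin n) K) n t) ∧
        (∀ T, z T ∈ Fk (MvPolynomial (Fin n) K) n (t + b)) ∧
        ∀ T, v T = dL K n _ y T + contract _ n f (z T) := by
  unfold TorNe
  refine exists_congr fun i => ?_
  constructor
  · rintro ⟨g, h1, h2, h3, h4⟩
    have h1' : ∀ T, ∃ y : Fk (MvPolynomial (Fin n) K) n t, y.1 ∈ strandW n K n e ∧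
        (T.card ≠ i → y = 0) ∧ toH f t b y = g T := by
      intro T
      by_cases hT : T.card = i
      · obtain ⟨y, hy1, hy2⟩ := (mem_topHgr _).1 (h1 T)
        exact ⟨y, hy1, fun h => absurd hT h, hy2⟩
      · exact ⟨0, zero_mem _, fun _ => rfl, by rw [h2 T hT, map_zero]⟩
    choose v hv1 hv2 hv3 using h1'
    have hg : g = fun T => toH f t b (v T) := funext fun T => (hv3 T).symm
    refine ⟨fun T => (v T).1, hv1, fun T => (v T).2, fun T hT => by simp [hv2 T hT], ?_, ?_⟩
    · intro T
      rw [← dL_val, ← toH_eq_zero, ← dL_toH, ← hg, h3]; rfl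
    · rw [← bdry_iff, ← hg]; exact h4
  · rintro ⟨v, h1, h2, h3, h4, h5⟩
    refine ⟨fun T => toH f t b ⟨v T, h2 T⟩, ?_, ?_, ?_, ?_⟩
    · intro T
      exact (mem_topHgr _).2 ⟨_, h1 T, rfl⟩
    · intro T hT
      rw [toH_eq_zero]
      simp [h3 T hT]
    · funext T
      rw [dL_toH]
      refine (toH_eq_zero _).2 ?_
      rw [dL_val]; exact h4 T
    · rw [bdry_iff]; exact h5

end AuxW
section AuxMain

variable {K : Type} [Field K]

lemma X_smul_range {m : ℕ} {N : Type} [AddCommGroup N] [Module (MvPolynomial (Fin m) K) N]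
    (g : Finset (Fin m) → N) (hg : dL K m N g = 0) (j : Fin m) :
    (X j : MvPolynomial (Fin m) K) • g ∈ LinearMap.range (dL K m N) := by
  classical
  let D : Fin m → N →+ N := fun k => if k = j then AddMonoidHom.id N else 0
  refine ⟨sL D g, ?_⟩
  funext T
  have h := homotopy (K := K) D (by
    intro a b x _
    simp only [D]
    split_ifs <;> simp) g T
  have h0 : sL D (dL K m N g) T = 0 := by
    rw [hg]; simp [sL]
  rw [h0, add_zero] at h
  rw [h]
  have h1 : ∀ l, (X l : MvPolynomial (Fin m) K) • D l (g T) =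
      if l = j then (X j : MvPolynomial (Fin m) K) • g T else 0 := by
    intro l
    simp only [D]
    split_ifs with hl
    · subst hl; rfl
    · simp
  have h2 : ∀ l, D l ((X l : MvPolynomial (Fin m) K) • (g T)) =
      if l = j then (X j : MvPolynomial (Fin m) K) • g T else 0 := by
    intro l
    simp only [D]
    split_ifs with hl
    · subst hl; rfl
    · simp
  simp only [h1, h2]
  rw [Finset.sum_compl_add_sum]
  simp

lemma span_le_aux {m : ℕ} {N : Type} [AddCommGroup N] [Module (MvPolynomial (Fin m) K) N]
    [Module K N] [IsScalarTower K (MvPolynomial (Fin m) K) N]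
    (G : Set (Finset (Fin m) → N)) (hG : ∀ g ∈ G, dL K m N g = 0) (x : Finset (Fin m) → N)
    (hx : x ∈ Submodule.span (MvPolynomial (Fin m) K) G) :
    x ∈ Submodule.span K G ⊔ (LinearMap.range (dL K m N)).restrictScalars K := by
  suffices h : dL K m N x = 0 ∧
      x ∈ Submodule.span K G ⊔ (LinearMap.range (dL K m N)).restrictScalars K from h.2
  induction hx using Submodule.span_induction with
  | mem x h => exact ⟨hG x h, Submodule.mem_sup_left (Submodule.subset_span h)⟩
  | zero => exact ⟨map_zero _, zero_mem _⟩
  | add x y _ _ hx hy => exact ⟨by rw [map_add, hx.1, hy.1, add_zero], add_mem hx.2 hy.2⟩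
  | smul p x _ hx =>
    refine ⟨by rw [map_smul, hx.1, smul_zero], ?_⟩
    induction p using MvPolynomial.induction_on with
    | C a =>
      have : (C a : MvPolynomial (Fin m) K) • x = a • x := by
        rw [← MvPolynomial.algebraMap_eq, algebraMap_smul]
      rw [this]
      exact Submodule.smul_mem _ _ hx.2
    | add p q hp hq => rw [add_smul]; exact add_mem hp hq
    | mul_X p j _ =>
      rw [mul_smul]
      refine Submodule.mem_sup_right ?_
      exact Submodule.smul_mem (LinearMap.range (dL K m N)) p (X_smul_range x hx.1 j)

variable {n r : ℕ} {f : MvPolynomial (Fin n) (MvPolynomial (Fin n) K)}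

lemma finite_Fk (k : ℕ) : Module.Finite (MvPolynomial (Fin n) K) (Fk (MvPolynomial (Fin n) K) n k) := by
  have : Finite {c : Fin n →₀ ℕ | tdeg c = k} := Finsupp.finite_of_degree_eq k
  exact Module.Finite.equiv (Finsupp.supportedEquivFinsupp (M := MvPolynomial (Fin n) K)
    (R := MvPolynomial (Fin n) K) {c : Fin n →₀ ℕ | tdeg c = k}).symm

lemma pr_smul {m n : ℕ} (k : ℕ) (a : K) (w : Wmod (MvPolynomial (Fin m) K) n) :
    pr K m n k (a • w) = a • pr K m n k w := by
  ext1 c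
  rw [pr_apply, Finsupp.smul_apply, map_smul, Finsupp.smul_apply, pr_apply]

lemma pr_large {m n : ℕ} (w : Wmod (MvPolynomial (Fin m) K) n) :
    ∃ B : ℕ, ∀ k > B, pr K m n k w = 0 := by
  refine ⟨w.support.sup fun c => (w c).totalDegree, fun k hk => ?_⟩
  ext1 c
  rw [pr_apply]
  by_cases hc : c ∈ w.support
  · have : (w c).totalDegree ≤ w.support.sup fun c => (w c).totalDegree :=
      Finset.le_sup (f := fun c => (w c).totalDegree) hc
    rw [homogeneousComponent_eq_zero _ _ (by omega)]; rfl
  · rw [Finsupp.notMem_support_iff.1 hc, map_zero]; rfl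

lemma bdd_TorH (hf : Diag r f) (t : ℕ) :
    BddAbove {e | TorNe K n (topH n K n f t r) (topHgr n K n f t r) e} := by
  classical
  have := finite_Fk (K := K) (n := n) t
  have : Module.Finite (MvPolynomial (Fin n) K) (topH n K n f t r) :=
    Module.Finite.of_surjective _ (toH_surj f t r)
  have : IsNoetherian (MvPolynomial (Fin n) K) (topH n K n f t r) :=
    isNoetherian_of_isNoetherianRing_of_finite _ _
  obtain ⟨G, hG⟩ := (isNoetherian_pi (R := MvPolynomial (Fin n) K) (ι := Finset (Fin n))
    (M := fun _ => topH n K n f t r)).noetherian (LinearMap.ker (dL K n (topH n K n f t r)))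
  choose Y hY using fun (g : Finset (Fin n) → topH n K n f t r) T => toH_surj f t r (g T)
  choose B hB using fun (g : Finset (Fin n) → topH n K n f t r) T => pr_large (Y g T).1
  let B' : ℕ := G.sup fun g => Finset.univ.sup fun T => B g T
  have hB' : ∀ g ∈ G, ∀ T, ∀ k > B', pr K n n k (Y g T).1 = 0 := by
    intro g hg T k hk
    refine hB g T k (lt_of_le_of_lt ?_ hk)
    refine le_trans ?_ (Finset.le_sup (f := fun g => Finset.univ.sup fun T => B g T) hg)
    exact Finset.le_sup (f := fun T => B g T) (Finset.mem_univ T)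
  have hspan : ∀ a ∈ Submodule.span K (G : Set (Finset (Fin n) → topH n K n f t r)),
      ∃ y : Finset (Fin n) → Fk (MvPolynomial (Fin n) K) n t, (∀ T, toH f t r (y T) = a T) ∧
        ∀ T, ∀ k > B', pr K n n k (y T).1 = 0 := by
    intro a ha
    induction ha using Submodule.span_induction with
    | mem x h => exact ⟨Y x, hY x, hB' x h⟩
    | zero => exact ⟨0, fun T => rfl, fun T k _ => map_zero _⟩
    | add x y _ _ hx hy =>
      obtain ⟨x', hx1, hx2⟩ := hx
      obtain ⟨y', hy1, hy2⟩ := hy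
      refine ⟨x' + y', fun T => ?_, fun T k hk => ?_⟩
      · rw [Pi.add_apply, Pi.add_apply, ← hx1, ← hy1]; rfl
      · rw [Pi.add_apply, Submodule.coe_add, map_add, hx2 T k hk, hy2 T k hk, add_zero]
    | smul c x _ hx =>
      obtain ⟨x', hx1, hx2⟩ := hx
      refine ⟨c • x', fun T => ?_, fun T k hk => ?_⟩
      · rw [Pi.smul_apply, Pi.smul_apply, ← hx1]; rfl
      · change pr K n n k (c • (x' T).1) = 0
        rw [pr_smul, hx2 T k hk, smul_zero]
  refine ⟨(B' + r : ℕ), ?_⟩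
  intro e he
  by_contra hlt
  push Not at hlt
  obtain ⟨i, g, h1, h2, h3, h4⟩ := he
  have hg : g ∈ Submodule.span (MvPolynomial (Fin n) K) (G : Set (Finset (Fin n) → topH n K n f t r)) := by
    rw [hG]; exact h3
  have hg' := span_le_aux _ (by
    intro x hx
    have : x ∈ LinearMap.ker (dL K n (topH n K n f t r)) := by
      rw [← hG]; exact Submodule.subset_span hx
    exact this) g hg
  obtain ⟨a, ha, _, ⟨b, rfl⟩, hab⟩ := Submodule.mem_sup.1 hg'
  obtain ⟨y, hy1, hy2⟩ := hspan a ha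
  choose v hv1 hv2 using fun T => (mem_topHgr _).1 (h1 T)
  obtain ⟨k, rfl⟩ : ∃ k : ℕ, e = ((k + 1 : ℕ) : ℤ) := ⟨(e - 1).toNat, by omega⟩
  have hk : B' + r < k + 1 := by exact_mod_cast hlt
  have hb : ∃ h, dL K n _ h = (fun T => toH f t r ((v - y) T)) := by
    refine ⟨b, ?_⟩
    have hab2 : dL K n _ b = g - a := eq_sub_of_add_eq' hab
    rw [hab2]
    funext T
    rw [Pi.sub_apply, Pi.sub_apply, toH_sub, hv2, hy1]
  obtain ⟨y', z, hy', hz, hyz⟩ := (bdry_iff _).1 hb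
  apply h4
  have hgv : g = fun T => toH f t r (v T) := funext fun T => (hv2 T).symm
  rw [hgv]
  refine (bdry_iff _).2 ⟨fun T => pr K n n k (y' T), fun T => pr K n n (k + 1 - r) (z T),
    fun T => pr_Fk _ (hy' T), fun T => pr_Fk _ (hz T), fun T => ?_⟩
  have h := congrArg (pr K n n (k + 1)) (hyz T)
  rw [Pi.sub_apply, Submodule.coe_sub, map_sub, hy2 T _ (by omega), sub_zero, pr_eq (hv1 T),
    map_add] at h
  rw [h, pr_dL, ← pr_contract hf]
  congr 3
  omega

lemma upper [CharZero K] (hf : Diag r f) (t : ℕ) (s : ℤ) (hs : (r : ℤ) - 1 ≤ s) (hr : 1 ≤ r)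
    (hH : ∀ e, TorNe K n (topH n K n f t r) (topHgr n K n f t r) e → e ≤ s) (e : ℤ)
    (he : TorNe K n (syzM n K n f t r) (syzGr n K n f t r r) e) : e ≤ s + 2 := by
  by_contra hlt
  push Not at hlt
  obtain ⟨i, w, h1, h2, h3, h4, h5⟩ := (TorM_iff _ _ _ _ _).1 he
  obtain ⟨u, u1, u2, u3, u4⟩ := exact_W w _ i h1 h3 h4 (by omega)
  have u5 : ∀ T, u T ∈ Fk (MvPolynomial (Fin n) K) n (t + r) :=
    u4 ((Fk (MvPolynomial (Fin n) K) n (t + r)).restrictScalars K)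
      (fun j T => DW_Fk (mem_syzM.1 (h2 T)).2 j)
  have hdphi : dL K n _ (fun T => contract _ n f (u T)) = 0 := by
    rw [dL_comp, u2]
    funext T
    exact (mem_syzM.1 (h2 T)).1
  obtain ⟨v, v1, v2, v3, v4⟩ := exact_W (fun T => contract _ n f (u T)) (e - 1) (i + 1)
    (fun T => by
      have := contract_strand hf (u3 T)
      convert this using 2; ring) (fun T hT => by simp only [u1 T hT, map_zero]) hdphi
    (by push_cast; omega)
  have v5 : ∀ T, v T ∈ Fk (MvPolynomial (Fin n) K) n t :=
    v4 ((Fk (MvPolynomial (Fin n) K) n t).restrictScalars K)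
      (fun j T => DW_Fk (contract_Fk hf (u5 T)) j)
  have hnot : ¬ TorNe K n (topH n K n f t r) (topHgr n K n f t r) (e - 1 - 1) := by
    intro h
    have := hH _ h
    omega
  rw [TorH_iff] at hnot
  push Not at hnot
  obtain ⟨y, z, hy, hz, hyz⟩ := hnot (i + 1 + 1) v v3 v5 v1 (fun T => by
    rw [v2]; exact mem_Uf.2 ⟨u T, u5 T, rfl⟩)
  apply h5
  refine ⟨u - dL K n _ z, fun T => ?_, ?_⟩
  · rw [mem_syzM]
    constructor
    · have e1 : v = dL K n _ y + fun T => contract _ n f (z T) := funext hyz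
      rw [e1, map_add, dL_dL, zero_add, dL_comp] at v2
      rw [Pi.sub_apply, map_sub, sub_eq_zero]
      exact (congr_fun v2 T).symm
    · refine sub_mem (u5 T) ?_
      rw [dL_apply]
      exact sum_mem fun l _ => zsmul_mem (Submodule.smul_mem _ _ (hz _)) _
  · rw [map_sub, dL_dL, sub_zero, u2]

lemma dL_mem {m : ℕ} {N : Type} [AddCommGroup N] [Module (MvPolynomial (Fin m) K) N]
    (L : Submodule (MvPolynomial (Fin m) K) N) (g : Finset (Fin m) → N) (hg : ∀ T, g T ∈ L) (T) :
    dL K m N g T ∈ L := by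
  rw [dL_apply]
  exact sum_mem fun l _ => zsmul_mem (Submodule.smul_mem _ _ (hg _)) _

lemma dL_strand {m : ℕ} (g : Finset (Fin m) → Wmod (MvPolynomial (Fin m) K) n) {k : ℕ}
    (hg : ∀ T, g T ∈ strandW n K m k) (T) :
    dL K m _ g T ∈ strandW n K m ((k + 1 : ℕ) : ℤ) := by
  have : g = fun T => pr K m n k (g T) := funext fun T => (pr_eq (hg T)).symm
  rw [this, pr_dL]
  exact pr_strand _ _

lemma lower [CharZero K] (hf : Diag r f) (t : ℕ) (ht : 1 ≤ t) (hr : 1 ≤ r)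
    (hH : TorNe K n (topH n K n f t r) (topHgr n K n f t r) ((t : ℤ) + r - 1)) :
    TorNe K n (syzM n K n f t r) (syzGr n K n f t r r) ((t : ℤ) + r + 1) := by
  obtain ⟨k, hk⟩ : ∃ k : ℕ, k + 1 = t + r := ⟨t + r - 1, by omega⟩
  have hk' : (t : ℤ) + r - 1 = k := by omega
  rw [hk'] at hH
  obtain ⟨i, w, h1, h2, h3, h4, h5⟩ := (TorH_iff _ _ _ _).1 hH
  have key : ∀ y : Finset (Fin n) → Wmod (MvPolynomial (Fin n) K) n,
      (∀ T, y T ∈ Fk (MvPolynomial (Fin n) K) n (t + r)) →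
      (∀ T, y T ∈ strandW n K n ((t : ℤ) - 1)) → (∀ T, T.card ≠ i → y T = 0) →
      dL K n _ w = dL K n _ (fun T => contract _ n f (y T)) → False := by
    intro y y1 y2 y3 y4
    apply h5
    have hs : ∀ T, w T - contract _ n f (y T) ∈ strandW n K n k := by
      intro T
      refine sub_mem (h1 T) ?_
      have := contract_strand hf (y2 T)
      convert this using 2; omega
    obtain ⟨q, q1, q2, q3, q4⟩ := exact_W (w - fun T => contract _ n f (y T)) k i hs
      (fun T hT => by rw [Pi.sub_apply, h3 T hT, y3 T hT, map_zero, sub_zero])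
      (by rw [map_sub, y4, sub_self]) (by omega)
    refine ⟨q, y, q4 ((Fk (MvPolynomial (Fin n) K) n t).restrictScalars K)
      (fun j T => DW_Fk (sub_mem (h2 T) (contract_Fk hf (y1 T))) j), y1, fun T => ?_⟩
    rw [q2, Pi.sub_apply, sub_add_cancel]
  choose z0 hz0 using fun T => mem_Uf.1 (h4 T)
  have hz : ∃ z : Finset (Fin n) → Wmod (MvPolynomial (Fin n) K) n,
      (∀ T, z T ∈ Fk (MvPolynomial (Fin n) K) n (t + r)) ∧ (∀ T, z T ∈ strandW n K n t) ∧
      (∀ T, T.card + 1 ≠ i → z T = 0) ∧ (fun T => contract _ n f (z T)) = dL K n _ w := by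
    refine ⟨fun T => if T.card + 1 = i then pr K n n t (z0 T) else 0, fun T => ?_, fun T => ?_,
      fun T hT => if_neg hT, ?_⟩
    · dsimp only
      split_ifs
      · exact pr_Fk _ (hz0 T).1
      · exact zero_mem _
    · dsimp only
      split_ifs
      · exact pr_strand _ _
      · exact zero_mem _
    · funext T
      dsimp only
      split_ifs with hT
      · rw [← pr_contract hf, (hz0 T).2]
        apply pr_eq
        rw [← hk]
        exact dL_strand w h1 T
      · rw [map_zero]
        cases i with
        | zero => rw [dL_supp_zero w h3]; rfl
        | succ i => rw [dL_supp w h3 T (by omega)]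
  obtain ⟨z, z1, z2, z3, z4⟩ := hz
  match i, h3, key, z3 with
  | 0, h3, key, z3 =>
    exfalso
    refine key 0 (fun T => zero_mem _) (fun T => zero_mem _) (fun _ _ => rfl) ?_
    rw [dL_supp_zero w h3]
    have : (fun T => contract _ n f ((0 : Finset (Fin n) → Wmod (MvPolynomial (Fin n) K) n) T)) = 0 := by
      funext T; simp
    rw [this, map_zero]
  | 1, h3, key, z3 =>
    exfalso
    obtain ⟨y, y1, y2, y3, y4⟩ := exact_W z t 0 z2 (fun T hT => z3 T (by omega))
      (dL_supp_zero _ (fun T hT => z3 T (by omega))) (by omega)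
    refine key y (y4 ((Fk (MvPolynomial (Fin n) K) n (t + r)).restrictScalars K)
      (fun j T => DW_Fk (z1 T) j)) y3 y1 ?_
    rw [dL_comp, y2, z4]
  | i + 2, h3, key, z3 =>
    rw [TorM_iff]
    refine ⟨i, dL K n _ z, fun T => ?_, fun T => ?_, fun T hT => ?_, dL_dL _, ?_⟩
    · have := dL_strand z z2 T
      convert this using 2
      push_cast; ring
    · rw [mem_syzM]
      refine ⟨?_, dL_mem _ _ z1 T⟩
      have := congr_fun (dL_comp (contract _ n f) z) T
      rw [← this, z4, dL_dL]; rfl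
    · exact dL_supp z (fun T hT => z3 T (by omega)) T hT
    · rintro ⟨u, hu1, hu2⟩
      let u' : Finset (Fin n) → Wmod (MvPolynomial (Fin n) K) n :=
        fun T => if T.card = i + 1 then pr K n n t (u T) else 0
      have hu1' : ∀ T, u' T ∈ syzM n K n f t r := by
        intro T
        simp only [u']
        split_ifs
        · exact pr_syzM hf _ (hu1 T)
        · exact zero_mem _
      have hus : ∀ T, u' T ∈ strandW n K n t := by
        intro T
        simp only [u']
        split_ifs
        · exact pr_strand _ _
        · exact zero_mem _
      have hu0 : ∀ T, T.card ≠ i + 1 → u' T = 0 := fun T hT => if_neg hT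
      have hu2' : dL K n _ u' = dL K n _ z := by
        funext T
        by_cases hT : T.card = i
        · have e1 : dL K n _ u' T = dL K n _ (fun T => pr K n n t (u T)) T := by
            rw [dL_apply, dL_apply]
            refine Finset.sum_congr rfl fun l hl => ?_
            have hl' : l ∉ T := by simpa using hl
            simp only [u']
            rw [if_pos (by rw [Finset.card_insert_of_notMem hl', hT])]
          rw [e1, pr_dL, hu2]
          exact pr_eq (dL_strand z z2 T)
        · rw [dL_supp u' hu0 T hT, dL_supp z (fun T hT => z3 T (by omega)) T hT]
      obtain ⟨y, y1, y2, y3, y4⟩ := exact_W (z - u') t (i + 1) (fun T => sub_mem (z2 T) (hus T))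
        (fun T hT => by rw [Pi.sub_apply, hu0 T hT, z3 T (by omega), sub_zero])
        (by rw [map_sub, hu2', sub_self]) (by omega)
      refine key y (y4 ((Fk (MvPolynomial (Fin n) K) n (t + r)).restrictScalars K)
        (fun j T => DW_Fk (sub_mem (z1 T) (mem_syzM.1 (hu1' T)).2) j)) y3 y1 ?_
      rw [dL_comp, y2, ← z4]
      funext T
      rw [Pi.sub_apply, map_sub, (mem_syzM.1 (hu1' T)).1, sub_zero]

end AuxMain
section AuxFinal

variable {K : Type} [Field K] {n r : ℕ} {f : MvPolynomial (Fin n) (MvPolynomial (Fin n) K)}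

lemma Diag.coeff_eq (hf : Diag r f) (β : Fin n →₀ ℕ) :
    coeff β f = monomial β (coeff β (coeff β f)) := by
  classical
  ext ν
  rw [coeff_monomial]
  split_ifs with h
  · rw [h]
  · by_contra h1
    exact h (hf _ _ h1).1.symm

/-- The diagonal coefficients of the powers of `fLam`. -/
noncomputable def al (l : Fin n → K) (r : ℕ) (β : Fin n →₀ ℕ) : K :=
  coeff β (coeff β (fLam l ^ r))

open scoped Classical in
lemma al_succ (l : Fin n → K) (r : ℕ) (β : Fin n →₀ ℕ) :
    al l (r + 1) β =
      ∑ k, if Finsupp.single k 1 ≤ β then al l r (β - Finsupp.single k 1) * l k else 0 := by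
  unfold al
  rw [pow_succ]
  nth_rewrite 2 [fLam_eq]
  rw [Finset.mul_sum, coeff_sum, coeff_sum]
  refine Finset.sum_congr rfl fun k _ => ?_
  rw [coeff_mul_monomial']
  split_ifs with h
  · rw [coeff_mul_monomial', if_pos h]
  · rw [coeff_zero]

lemma single_le_iff (k : Fin n) (β : Fin n →₀ ℕ) : Finsupp.single k 1 ≤ β ↔ β k ≠ 0 := by
  rw [Finsupp.single_le_iff]; omega

lemma al_single (l : Fin n → K) (i : Fin n) (r : ℕ) : al l r (Finsupp.single i r) = l i ^ r := by
  classical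
  induction r with
  | zero => simp [al]
  | succ r ih =>
    rw [al_succ, Finset.sum_eq_single i]
    · rw [if_pos ((single_le_iff _ _).2 (by simp)), pow_succ, ← ih]
      congr 2
      rw [← Finsupp.single_tsub]
      rfl
    · intro k _ hk
      rw [if_neg]
      rw [single_le_iff, Finsupp.single_eq_of_ne hk]
      simp
    · simp

lemma al_pair (l : Fin n → K) {i j : Fin n} (hij : i ≠ j) (r : ℕ) :
    al l (r + 1) (Finsupp.single i r + Finsupp.single j 1) = (r + 1 : K) * l i ^ r * l j := by
  classical
  induction r with
  | zero =>
    have := al_single l j 1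
    simpa using this
  | succ r ih =>
    rw [al_succ, ← Finset.sum_subset (Finset.subset_univ {i, j}), Finset.sum_pair hij,
      if_pos ((single_le_iff _ _).2 (by simp)), if_pos ((single_le_iff _ _).2 (by simp))]
    · have e1 : Finsupp.single i (r + 1) + Finsupp.single j 1 - Finsupp.single i 1 =
          Finsupp.single i r + Finsupp.single j 1 := by
        rw [Finsupp.single_add, add_right_comm, add_tsub_cancel_right]
      have e2 : Finsupp.single i (r + 1) + Finsupp.single j 1 - Finsupp.single j 1 =
          Finsupp.single i (r + 1) := by
        rw [add_tsub_cancel_right]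
      rw [e1, e2, ih, al_single]
      push_cast
      ring
    · intro k _ hk
      simp only [Finset.mem_insert, Finset.mem_singleton, not_or] at hk
      rw [if_neg]
      rw [single_le_iff, Finsupp.add_apply, Finsupp.single_eq_of_ne hk.1,
        Finsupp.single_eq_of_ne hk.2]
      simp

lemma le_tdeg_eq {β c : Fin n →₀ ℕ} (h : β ≤ c) (ht : tdeg β = tdeg c) : β = c := by
  obtain ⟨d, rfl⟩ := exists_add_of_le h
  rw [tdeg_add] at ht
  have hd : d.degree = 0 := by
    rw [← tdeg_eq]; omega
  rw [(Finsupp.degree_eq_zero_iff d).1 hd, add_zero]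

lemma syz_coeff_zero (hf : Diag r f) (c : Fin n →₀ ℕ) (hc : coeff c (coeff c f) ≠ 0)
    {u : Wmod (MvPolynomial (Fin n) K) n} (hu : u ∈ syzM n K n f 0 r) : coeff 0 (u c) = 0 := by
  classical
  have h := (mem_syzM.1 hu).1
  have h1 := contract_apply f u 0
  rw [h] at h1
  have h2 := congrArg (coeff c) h1
  rw [coeff_sum, Finset.sum_eq_single c] at h2
  · rw [hf.coeff_eq c, coeff_monomial_mul', if_pos le_rfl, tsub_self, zero_add] at h2
    simp only [Finsupp.coe_zero, Pi.zero_apply, coeff_zero] at h2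
    exact (mul_eq_zero.1 h2.symm).resolve_left hc
  · intro β hβ hne
    rw [hf.coeff_eq β, coeff_monomial_mul', if_neg]
    intro hle
    exact hne (le_tdeg_eq hle ((hf.tdeg_supp hβ).trans (hf _ _ hc).2.symm))
  · intro hc'
    rw [notMem_support_iff.1 hc', zero_mul, coeff_zero]

lemma pair_zero [CharZero K] (l : Fin n → K) {i j : Fin n} (hij : i ≠ j) (hi : l i ≠ 0)
    (hj : l j ≠ 0) (hr : 1 ≤ r) :
    TorNe K n (syzM n K n (fLam l ^ r) 0 r) (syzGr n K n (fLam l ^ r) 0 r r) ((r : ℤ) + 1) := by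
  classical
  obtain ⟨q, rfl⟩ : ∃ q, r = q + 1 := ⟨r - 1, by omega⟩
  set f := fLam l ^ (q + 1) with hfdef
  have hf : Diag (q + 1) f := Diag_pow l (q + 1)
  set c : Fin n →₀ ℕ := Finsupp.single i (q + 1) with hc
  set c' : Fin n →₀ ℕ := Finsupp.single i q + Finsupp.single j 1 with hc'
  have a1 : coeff c (coeff c f) ≠ 0 := by
    have : coeff c (coeff c f) = _ := al_single l i (q + 1)
    rw [this]
    exact pow_ne_zero _ hi
  have a2 : coeff c' (coeff c' f) ≠ 0 := by
    have : coeff c' (coeff c' f) = _ := al_pair l hij q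
    rw [this]
    exact mul_ne_zero (mul_ne_zero (by exact_mod_cast Nat.succ_ne_zero q) (pow_ne_zero _ hi)) hj
  have hcc : c ≠ c' := by
    intro h
    have := DFunLike.congr_fun h j
    simp [hc, hc', Finsupp.single_eq_of_ne hij.symm] at this
  have t1 : tdeg c = q + 1 := (hf _ _ a1).2
  have t2 : tdeg c' = q + 1 := (hf _ _ a2).2
  set A := coeff c (coeff c f) with hA
  set A' := coeff c' (coeff c' f) with hA'
  let x : Wmod (MvPolynomial (Fin n) K) n :=
    Finsupp.single c (monomial (Finsupp.single j 1) A') -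
      Finsupp.single c' (monomial (Finsupp.single i 1) A)
  have xc : x c = monomial (Finsupp.single j 1) A' := by
    simp [x, Finsupp.single_eq_of_ne hcc]
  have xc' : x c' = - monomial (Finsupp.single i 1) A := by
    simp [x, Finsupp.single_eq_of_ne hcc.symm]
  have xo : ∀ d, d ≠ c → d ≠ c' → x d = 0 := by
    intro d h1 h2
    simp [x, Finsupp.single_eq_of_ne h1, Finsupp.single_eq_of_ne h2]
  have xF : x ∈ Fk (MvPolynomial (Fin n) K) n (0 + (q + 1)) := by
    rw [mem_Fk]
    intro d hd
    by_cases h1 : d = c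
    · rw [h1, t1, zero_add]
    by_cases h2 : d = c'
    · rw [h2, t2, zero_add]
    exact absurd (xo d h1 h2) hd
  have xs : x ∈ strandW n K n (((q + 1 : ℕ) : ℤ) + 1 - ((q + 1 : ℕ) : ℤ)) := by
    rw [mem_strandW]
    intro d ν hν
    have key : tdeg ν = 1 := by
      by_cases h1 : d = c
      · rw [h1, xc, coeff_monomial] at hν
        split_ifs at hν with h
        · rw [← h]; simp [tdeg_eq]
        · exact absurd rfl hν
      by_cases h2 : d = c'
      · rw [h2, xc', coeff_neg, coeff_monomial] at hν
        split_ifs at hν with h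
        · rw [← h]; simp [tdeg_eq]
        · simp at hν
      rw [xo d h1 h2] at hν
      simp at hν
    rw [key]; push_cast; ring
  have xk : x ∈ syzM n K n f 0 (q + 1) := by
    refine mem_syzM.2 ⟨?_, xF⟩
    ext1 d
    by_cases hd : d = 0
    · subst hd
      rw [contract_apply, ← Finset.sum_subset (s₁ := {c, c'}), Finset.sum_pair hcc]
      · rw [zero_add, zero_add, xc, xc', hf.coeff_eq c, hf.coeff_eq c', ← hA, ← hA', mul_neg,
          monomial_mul, monomial_mul, mul_comm A' A]
        have : c + Finsupp.single j 1 = c' + Finsupp.single i 1 := by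
          rw [hc, hc', Finsupp.single_add, add_right_comm]
        rw [this, add_neg_cancel]
        rfl
      · intro β hβ
        rw [Finset.mem_insert, Finset.mem_singleton] at hβ
        rw [mem_support_iff]
        rcases hβ with h | h
        · rw [h]; intro h0; rw [hA, h0, coeff_zero] at a1; exact a1 rfl
        · rw [h]; intro h0; rw [hA', h0, coeff_zero] at a2; exact a2 rfl
      · intro β _ hβ
        rw [Finset.mem_insert, Finset.mem_singleton, not_or] at hβ
        rw [zero_add, xo β hβ.1 hβ.2, mul_zero]
    · by_contra h
      have := (mem_Fk _ _).1 (contract_Fk hf xF) d h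
      rw [tdeg_eq, Finsupp.degree_eq_zero_iff] at this
      exact hd this
  rw [TorM_iff]
  refine ⟨0, fun T => if T = ∅ then x else 0, ?_, ?_, ?_, ?_, ?_⟩
  · intro T
    dsimp only
    split_ifs
    · exact xs
    · exact zero_mem _
  · intro T
    dsimp only
    split_ifs
    · exact xk
    · exact zero_mem _
  · intro T hT
    dsimp only
    rw [if_neg]
    rintro rfl
    exact hT rfl
  · funext T
    rw [dL_apply]
    refine Finset.sum_eq_zero fun k _ => ?_
    rw [if_neg (Finset.insert_ne_empty _ _), smul_zero, smul_zero]
  · rintro ⟨u, hu, hd⟩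
    have h := congr_fun hd ∅
    rw [dL_apply, if_pos rfl] at h
    have h1 := congrArg (fun w => coeff (Finsupp.single j 1) (w c)) h
    rw [xc, coeff_monomial, if_pos rfl] at h1
    apply a2
    rw [← h1, Finsupp.finsetSum_apply, coeff_sum]
    refine Finset.sum_eq_zero fun k _ => ?_
    rw [Finsupp.smul_apply, Finsupp.smul_apply, zsmul_eq_mul, smul_eq_mul,
      ← map_intCast (C : K →+* MvPolynomial (Fin n) K), coeff_C_mul, coeff_X_mul']
    split_ifs with hk
    · have : k = j := by
        by_contra hkj
        rw [Finsupp.mem_support_iff, Finsupp.single_eq_of_ne hkj] at hk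
        exact hk rfl
      rw [this, tsub_self, syz_coeff_zero hf c a1 (hu _), mul_zero]
    · rw [mul_zero]

lemma exists_pair [CharZero K] (l : Fin n → K) (hn : 2 ≤ n)
    (h : TorNe K n (syzM n K n (fLam l ^ r) 1 r) (syzGr n K n (fLam l ^ r) 1 r r)
      ((r : ℤ) + 2)) : ∃ i j, i ≠ j ∧ l i ≠ 0 ∧ l j ≠ 0 := by
  classical
  by_contra hno
  push Not at hno
  obtain ⟨i₀, hi₀⟩ : ∃ i₀, ∀ k, k ≠ i₀ → l k = 0 := by
    by_cases hall : ∀ k, l k = 0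
    · exact ⟨⟨0, by omega⟩, fun k _ => hall k⟩
    · push Not at hall
      obtain ⟨i₀, h0⟩ := hall
      exact ⟨i₀, fun k hk => hno i₀ k hk.symm h0⟩
  have hfl : fLam l = monomial (Finsupp.single i₀ 1) (monomial (Finsupp.single i₀ 1) (l i₀)) := by
    rw [fLam_eq, Finset.sum_eq_single i₀]
    · intro k _ hk
      rw [hi₀ k hk, map_zero, map_zero]
    · simp
  have hpow : fLam l ^ r =
      monomial (r • Finsupp.single i₀ 1) (monomial (r • Finsupp.single i₀ 1) (l i₀ ^ r)) := by
    rw [hfl, monomial_pow, monomial_pow]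
  set s := r • Finsupp.single i₀ 1
  have hcon : ∀ w d, contract _ n (fLam l ^ r) w d = monomial s (l i₀ ^ r) * w (d + s) := by
    intro w d
    rw [contract_apply, hpow, Finset.sum_eq_single s]
    · rw [coeff_monomial, if_pos rfl]
    · intro β _ hβ
      rw [coeff_monomial, if_neg hβ.symm, zero_mul]
    · intro h0
      rw [notMem_support_iff.1 h0, zero_mul]
  obtain ⟨i, w, h1, h2, h3, h4, h5⟩ := (TorM_iff _ _ _ _ _).1 h
  obtain ⟨u, -, u2, -, u4⟩ := exact_W w _ i h1 h3 h4 (by omega)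
  apply h5
  refine ⟨u, fun T => u4 ((syzM n K n (fLam l ^ r) 1 r).restrictScalars K) ?_ T, u2⟩
  intro j T
  rw [Submodule.restrictScalars_mem]
  have hw := mem_syzM.1 (h2 T)
  refine mem_syzM.2 ⟨?_, DW_Fk hw.2 j⟩
  ext1 d
  have hz := hcon (w T) d
  rw [hw.1] at hz
  rw [hcon, DW_apply]
  rcases mul_eq_zero.1 hz.symm with h0 | h0
  · rw [h0, zero_mul]; rfl
  · rw [h0, map_zero, mul_zero]; rfl

end AuxFinal

/-- **Corollary (paper, Corollary 4.4).** Under the assumptions of Theorem 4.1 (i.e. `λ` lies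
in the Zariski open set on which `reg H^n_{P₊}(P/f_λ^r P)_j = -n-j+r-1`), one has
`reg H^{n-1}_{P₊}(P/f_λ^r P)_j = -n - j + r + 1` for all `j ≤ -n` (i.e. `t + r + 1` for
`j = -n-t`).  Here `H^{n-1}_{P₊}(R)_j` is the second syzygy module (the kernel) in the
presentation of `H^n_{P₊}(R)_j` coming from `0 → P(-r,-r) → P → R → 0`, with its
grading shifted by the twist `(-r)`. -/
theorem regularity_of_second_top_local_cohomology_of_powers_of_generic_linear_form
    (K : Type) [Field K] [CharZero K] (n r : ℕ) (hn : 2 ≤ n) (hr : 1 ≤ r)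
    (l : Fin n → K)
    (hreg : ∀ t : ℕ,
      CMreg K n ↥(topH n K n (fLam l ^ r) t r) (topHgr n K n (fLam l ^ r) t r) =
        (t : ℤ) + r - 1)
    (t : ℕ) :
    CMreg K n ↥(syzM n K n (fLam l ^ r) t r) (syzGr n K n (fLam l ^ r) t r r) =
      (t : ℤ) + r + 1 := by
  have hf : Diag r (fLam l ^ r) := Diag_pow l r
  have hreg2 : ∀ t : ℕ, sSup {e | TorNe K n (topH n K n (fLam l ^ r) t r)
      (topHgr n K n (fLam l ^ r) t r) e} = (t : ℤ) + r - 1 := fun t => by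
    rw [← CMreg_eq, hreg t]
  have hlow : ∀ t : ℕ, 1 ≤ t → TorNe K n (syzM n K n (fLam l ^ r) t r)
      (syzGr n K n (fLam l ^ r) t r r) ((t : ℤ) + r + 1) := by
    intro t ht
    apply lower hf t ht hr
    have hne : {e | TorNe K n (topH n K n (fLam l ^ r) t r)
        (topHgr n K n (fLam l ^ r) t r) e}.Nonempty := by
      rw [Set.nonempty_iff_ne_empty]
      intro h0
      have h := hreg2 t
      rw [h0, Int.csSup_empty] at h
      omega
    have hm := Int.csSup_mem hne (bdd_TorH hf t)
    rw [hreg2 t] at hm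
    exact hm
  rw [CMreg_eq]
  apply IsGreatest.csSup_eq
  constructor
  · rcases Nat.eq_zero_or_pos t with h0 | h0
    · subst h0
      have h1 := hlow 1 le_rfl
      have e1 : ((1 : ℕ) : ℤ) + r + 1 = (r : ℤ) + 2 := by push_cast; ring
      rw [e1] at h1
      obtain ⟨i, j, hij, hi, hj⟩ := exists_pair l hn h1
      have e2 : ((0 : ℕ) : ℤ) + r + 1 = (r : ℤ) + 1 := by push_cast; ring
      rw [Set.mem_ofPred_eq, e2]
      exact pair_zero l hij hi hj hr
    · exact hlow t h0
  · intro e he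
    have := upper hf t ((t : ℤ) + r - 1) (by omega) hr (fun e he => by
      rw [← hreg2 t]
      exact le_csSup (bdd_TorH hf t) he) e he
    omega

end Paper
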